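/- arXiv:1607.03351 — 2 statements merged into one kernel-verified Lean document; each statement's English description precedes it below -/
import Mathlib

section
/- Let (α,β,γ) and (α',β',γ') be triples of angles in (0,π) with α+β+γ = π and α'+β'+γ' = π. If cot(α/2)+cot(β/2)+cot(γ/2) = cot(α'/2)+cot(β'/2)+cot(γ'/2) and φ(α)+φ(β)+φ(γ) = φ(α')+φ(β')+φ(γ'), then (α',β',γ') is a permutation of (α,β,γ). (This is the analytic core of the theorem that heat content determines planar triangles: area and perimeter determine the scale and the value of the cotangent sum, while the third heat content coefficient determines the value of the φ-sum.) -/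
open Real Set

/-- The angle function appearing in the heat content asymptotics of a polygon:
`φ(θ) = ∫₀^∞ sinh((π−θ)ξ) / (sinh(πξ)·cosh(θξ)) dξ`. -/
noncomputable def phi (θ : ℝ) : ℝ :=
  ∫ ξ in Ioi (0:ℝ), Real.sinh ((π - θ) * ξ) / (Real.sinh (π * ξ) * Real.cosh (θ * ξ))

namespace HeatTri
open MeasureTheory Filter Topology

noncomputable def cc (ξ : ℝ) : ℝ := Real.cosh (π * ξ) / Real.sinh (π * ξ)
noncomputable def F0 (θ ξ : ℝ) : ℝ := 1 - cc ξ * (Real.sinh (θ * ξ) / Real.cosh (θ * ξ))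
noncomputable def F1 (θ ξ : ℝ) : ℝ := -(cc ξ * ξ / Real.cosh (θ * ξ) ^ 2)
noncomputable def F2 (θ ξ : ℝ) : ℝ :=
  2 * (cc ξ * ξ) * ξ * Real.sinh (θ * ξ) / Real.cosh (θ * ξ) ^ 3

lemma cc_pos {ξ : ℝ} (h : 0 < ξ) : 0 < cc ξ :=
  div_pos (Real.cosh_pos _) (Real.sinh_pos_iff.2 (by positivity))

lemma cc_anti {x y : ℝ} (hy : 0 < y) (hxy : y ≤ x) : cc x ≤ cc y := by
  unfold cc
  have h1 : 0 < Real.sinh (π * x) := Real.sinh_pos_iff.2 (mul_pos pi_pos (hy.trans_le hxy))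
  have h2 : 0 < Real.sinh (π * y) := Real.sinh_pos_iff.2 (by positivity)
  rw [div_le_div_iff₀ h1 h2]
  have h3 : 0 ≤ Real.sinh (π * x - π * y) := by
    rw [Real.sinh_nonneg_iff]
    have := mul_le_mul_of_nonneg_left hxy pi_pos.le
    linarith
  rw [Real.sinh_sub] at h3
  linarith

lemma cc_mul_le {ξ : ℝ} (h : 0 < ξ) : cc ξ * ξ ≤ 1 + ξ := by
  have hp : 0 < π * ξ := by positivity
  have h1 : 0 < Real.sinh (π * ξ) := Real.sinh_pos_iff.2 hp
  have h2 : π * ξ ≤ Real.sinh (π * ξ) := Real.self_le_sinh_iff.2 hp.le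
  have h3 := Real.cosh_sub_sinh (π * ξ)
  have h4 : Real.exp (-(π * ξ)) ≤ 1 := Real.exp_le_one_iff.2 (by linarith)
  have h5 : ξ ≤ π * ξ := by nlinarith [Real.pi_gt_three]
  unfold cc
  rw [div_mul_eq_mul_div, div_le_iff₀ h1]
  nlinarith

lemma inv_cosh_le (x : ℝ) : 1 / Real.cosh x ≤ 2 * Real.exp (-x) := by
  rw [div_le_iff₀ (Real.cosh_pos _), Real.cosh_eq]
  have : Real.exp (-x) * Real.exp x = 1 := by rw [← Real.exp_add]; simp
  nlinarith [Real.exp_pos (-x)]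

lemma sinh_div_cosh_le {x : ℝ} : Real.sinh x / Real.cosh x ≤ 1 := by
  rw [div_le_one (Real.cosh_pos _)]; exact (Real.sinh_lt_cosh x).le

lemma meas0 (θ : ℝ) : Measurable (F0 θ) := by unfold F0 cc; fun_prop
lemma meas1 (θ : ℝ) : Measurable (F1 θ) := by unfold F1 cc; fun_prop
lemma meas2 (θ : ℝ) : Measurable (F2 θ) := by unfold F2 cc; fun_prop

lemma bd1 {δ θ ξ : ℝ} (hθ : δ ≤ θ) (hξ : 0 < ξ) :
    |F1 θ ξ| ≤ 2 * (1 + ξ) * Real.exp (-δ * ξ) := by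
  have hc := Real.cosh_pos (θ * ξ)
  have h1 : 0 ≤ cc ξ * ξ := (mul_pos (cc_pos hξ) hξ).le
  have h2 := cc_mul_le hξ
  have h3 : 1 / Real.cosh (θ * ξ) ≤ 2 * Real.exp (-δ * ξ) := by
    refine (inv_cosh_le _).trans ?_
    have : Real.exp (-(θ * ξ)) ≤ Real.exp (-δ * ξ) := Real.exp_le_exp.2 (by nlinarith)
    linarith
  have h4 : 1 / Real.cosh (θ * ξ) ≤ 1 := by
    rw [div_le_one hc]; exact Real.one_le_cosh _
  have h5 : 0 < 1 / Real.cosh (θ * ξ) := by positivity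
  have e : F1 θ ξ = -(cc ξ * ξ * ((1 / Real.cosh (θ * ξ)) * (1 / Real.cosh (θ * ξ)))) := by
    unfold F1; field_simp
  rw [e, abs_neg, abs_of_nonneg (by positivity)]
  calc cc ξ * ξ * ((1 / Real.cosh (θ * ξ)) * (1 / Real.cosh (θ * ξ)))
      ≤ (1 + ξ) * ((2 * Real.exp (-δ * ξ)) * 1) := by gcongr
    _ = _ := by ring

lemma F2_pos {θ ξ : ℝ} (hθ : 0 < θ) (hξ : 0 < ξ) : 0 < F2 θ ξ := by
  have hc := Real.cosh_pos (θ * ξ)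
  have h1 : 0 < cc ξ * ξ := (mul_pos (cc_pos hξ) hξ)
  have hs : 0 < Real.sinh (θ * ξ) := Real.sinh_pos_iff.2 (by positivity)
  unfold F2; positivity

lemma bd2 {δ θ ξ : ℝ} (hδ : 0 < δ) (hθ : δ ≤ θ) (hξ : 0 < ξ) :
    |F2 θ ξ| ≤ 4 * (1 + ξ) * ξ * Real.exp (-δ * ξ) := by
  have hc := Real.cosh_pos (θ * ξ)
  rw [abs_of_pos (F2_pos (hδ.trans_le hθ) hξ)]
  have h := bd1 hθ hξ
  have e : F2 θ ξ = 2 * |F1 θ ξ| * ξ * (Real.sinh (θ * ξ) / Real.cosh (θ * ξ)) := by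
    unfold F1 F2
    rw [abs_neg, abs_of_pos (div_pos (mul_pos (cc_pos hξ) hξ) (by positivity))]
    field_simp
  rw [e]
  calc 2 * |F1 θ ξ| * ξ * (Real.sinh (θ * ξ) / Real.cosh (θ * ξ))
      ≤ 2 * |F1 θ ξ| * ξ * 1 := by
        gcongr; exact sinh_div_cosh_le
    _ ≤ 2 * (2 * (1 + ξ) * Real.exp (-δ * ξ)) * ξ * 1 := by gcongr
    _ = _ := by ring

lemma int_pow (n : ℕ) {δ : ℝ} (hδ : 0 < δ) :
    IntegrableOn (fun x : ℝ => x ^ n * Real.exp (-δ * x)) (Ioi 0) := by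
  have := integrableOn_rpow_mul_exp_neg_mul_rpow (p := 1) (s := n) (b := δ)
    (by have : (0:ℝ) ≤ n := n.cast_nonneg
        linarith) one_pos hδ
  simpa using this

lemma intb1 {δ : ℝ} (hδ : 0 < δ) :
    IntegrableOn (fun ξ : ℝ => 2 * (1 + ξ) * Real.exp (-δ * ξ)) (Ioi 0) := by
  have := ((int_pow 0 hδ).add (int_pow 1 hδ)).const_mul 2
  refine this.congr (ae_of_all _ fun x => ?_)
  simp; ring

lemma intb2 {δ : ℝ} (hδ : 0 < δ) :
    IntegrableOn (fun ξ : ℝ => 4 * (1 + ξ) * ξ * Real.exp (-δ * ξ)) (Ioi 0) := by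
  have := ((int_pow 1 hδ).add (int_pow 2 hδ)).const_mul 4
  refine this.congr (ae_of_all _ fun x => ?_)
  simp; ring

lemma F0_eq {θ ξ : ℝ} (hξ : 0 < ξ) :
    Real.sinh ((π - θ) * ξ) / (Real.sinh (π * ξ) * Real.cosh (θ * ξ)) = F0 θ ξ := by
  have hc := Real.cosh_pos (θ * ξ)
  have hs : 0 < Real.sinh (π * ξ) := Real.sinh_pos_iff.2 (by positivity)
  unfold F0 cc
  rw [sub_mul, Real.sinh_sub]
  field_simp

lemma phi_eq (θ : ℝ) : phi θ = ∫ ξ in Ioi (0:ℝ), F0 θ ξ :=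
  setIntegral_congr_fun measurableSet_Ioi fun _ hξ => F0_eq hξ

lemma int0 {θ : ℝ} (hθ : θ ∈ Ioo 0 π) : IntegrableOn (F0 θ) (Ioi 0) := by
  refine Integrable.mono' ((int_pow 0 hθ.1).const_mul 2) (meas0 θ).aestronglyMeasurable ?_
  filter_upwards [self_mem_ae_restrict measurableSet_Ioi] with ξ hξ
  have hξ : 0 < ξ := hξ
  have hc := Real.cosh_pos (θ * ξ)
  have hs : 0 < Real.sinh (π * ξ) := Real.sinh_pos_iff.2 (by positivity)
  have hs' : 0 < Real.sinh ((π - θ) * ξ) :=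
    Real.sinh_pos_iff.2 (mul_pos (by linarith [hθ.2]) hξ)
  have hle : Real.sinh ((π - θ) * ξ) ≤ Real.sinh (π * ξ) :=
    Real.sinh_le_sinh.2 (by nlinarith [hθ.1])
  rw [← F0_eq hξ, Real.norm_eq_abs, abs_of_pos (by positivity)]
  have h1 : Real.sinh ((π - θ) * ξ) / (Real.sinh (π * ξ) * Real.cosh (θ * ξ))
      ≤ 1 / Real.cosh (θ * ξ) := by
    rw [div_le_div_iff₀ (by positivity) hc]
    nlinarith
  refine h1.trans ((inv_cosh_le _).trans ?_)
  simp

lemma d0 (θ ξ : ℝ) : HasDerivAt (fun t => F0 t ξ) (F1 θ ξ) θ := by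
  have hc := (Real.cosh_pos (θ * ξ)).ne'
  have hl : HasDerivAt (fun t : ℝ => t * ξ) ξ θ := by simpa using (hasDerivAt_id θ).mul_const ξ
  have := ((hl.sinh.div hl.cosh hc).const_mul (cc ξ)).const_sub 1
  refine this.congr_deriv ?_
  unfold F1
  have := Real.cosh_sq_sub_sinh_sq (θ * ξ)
  field_simp
  linear_combination (-(cc ξ * ξ)) * this

lemma d1 (θ ξ : ℝ) : HasDerivAt (fun t => F1 t ξ) (F2 θ ξ) θ := by
  have hc := (Real.cosh_pos (θ * ξ)).ne'
  have hl : HasDerivAt (fun t : ℝ => t * ξ) ξ θ := by simpa using (hasDerivAt_id θ).mul_const ξ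
  have := ((hasDerivAt_const θ (cc ξ * ξ)).div (hl.cosh.pow 2) (pow_ne_zero 2 hc)).neg
  refine this.congr_deriv ?_
  unfold F2
  simp
  field_simp

lemma D0 {θ : ℝ} (hθ : θ ∈ Ioo 0 π) : IntegrableOn (F1 θ) (Ioi 0) ∧
    HasDerivAt (fun t => ∫ ξ in Ioi (0:ℝ), F0 t ξ) (∫ ξ in Ioi (0:ℝ), F1 θ ξ) θ := by
  have h2 : 0 < θ / 2 := by linarith [hθ.1]
  refine hasDerivAt_integral_of_dominated_loc_of_deriv_le (s := Ioi (θ / 2))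
    (bound := fun ξ => 2 * (1 + ξ) * Real.exp (-(θ/2) * ξ))
    (Ioi_mem_nhds (by linarith)) (Eventually.of_forall fun x => (meas0 x).aestronglyMeasurable)
    (int0 hθ) (meas1 θ).aestronglyMeasurable ?_ (intb1 h2) ?_
  · filter_upwards [self_mem_ae_restrict measurableSet_Ioi] with ξ hξ x hx
    exact bd1 (le_of_lt hx) hξ
  · exact ae_of_all _ fun ξ x _ => d0 x ξ

lemma D1 {θ : ℝ} (hθ : θ ∈ Ioo 0 π) : IntegrableOn (F2 θ) (Ioi 0) ∧
    HasDerivAt (fun t => ∫ ξ in Ioi (0:ℝ), F1 t ξ) (∫ ξ in Ioi (0:ℝ), F2 θ ξ) θ := by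
  have h2 : 0 < θ / 2 := by linarith [hθ.1]
  refine hasDerivAt_integral_of_dominated_loc_of_deriv_le (s := Ioi (θ / 2))
    (bound := fun ξ => 4 * (1 + ξ) * ξ * Real.exp (-(θ/2) * ξ))
    (Ioi_mem_nhds (by linarith)) (Eventually.of_forall fun x => (meas1 x).aestronglyMeasurable)
    (D0 hθ).1 (meas2 θ).aestronglyMeasurable ?_ (intb2 h2) ?_
  · filter_upwards [self_mem_ae_restrict measurableSet_Ioi] with ξ hξ x hx
    exact bd2 h2 (le_of_lt hx) hξ
  · exact ae_of_all _ fun ξ x _ => d1 x ξ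

noncomputable def I1 (θ : ℝ) : ℝ := ∫ ξ in Ioi (0:ℝ), F1 θ ξ
noncomputable def I2 (θ : ℝ) : ℝ := ∫ ξ in Ioi (0:ℝ), F2 θ ξ

lemma I2_pos {θ : ℝ} (hθ : θ ∈ Ioo 0 π) : 0 < I2 θ := by
  unfold I2
  rw [setIntegral_pos_iff_support_of_nonneg_ae _ (D1 hθ).1]
  · have : Function.support (F2 θ) ∩ Ioi 0 = Ioi 0 :=
      inter_eq_right.2 fun ξ hξ => (F2_pos hθ.1 hξ).ne'
    have h0 : (0 : ENNReal) < volume (Ioi (0:ℝ)) := by simp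
    rw [← this] at h0
    exact h0
  · filter_upwards [self_mem_ae_restrict measurableSet_Ioi] with ξ hξ
    exact (F2_pos hθ.1 hξ).le

lemma I2_mono {a b : ℝ} (ha : a ∈ Ioo 0 π) (hb : b ∈ Ioo 0 π) (hab : a ≤ b) :
    a ^ 3 * I2 a ≤ b ^ 3 * I2 b := by
  have ha0 := ha.1
  have hb0 := hb.1
  set k := a / b with hk
  have hk0 : 0 < k := by positivity
  have hk1 : k ≤ 1 := by rw [hk, div_le_one hb0]; exact hab
  have hkb : k * b = a := by rw [hk]; field_simp
  have h1 := integral_comp_mul_left_Ioi (F2 b) 0 hk0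
  simp only [mul_zero, smul_eq_mul] at h1
  have hint : IntegrableOn (fun x => F2 b (k * x)) (Ioi 0) := by
    rw [integrableOn_Ioi_comp_mul_left_iff _ _ hk0, mul_zero]
    exact (D1 hb).1
  have h2 : ∫ x in Ioi (0:ℝ), k ^ 2 * F2 a x ≤ ∫ x in Ioi (0:ℝ), F2 b (k * x) := by
    refine setIntegral_mono_on ((D1 ha).1.const_mul _) hint measurableSet_Ioi fun x hx => ?_
    have hx : 0 < x := hx
    have e : b * (k * x) = a * x := by rw [← hkb]; ring
    have hs : 0 < Real.sinh (a * x) := Real.sinh_pos_iff.2 (by positivity)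
    have hc := Real.cosh_pos (a * x)
    have hcc : cc x ≤ cc (k * x) := cc_anti (by positivity) (by nlinarith)
    unfold F2
    rw [e]
    calc k ^ 2 * (2 * (cc x * x) * x * Real.sinh (a * x) / Real.cosh (a * x) ^ 3)
        = cc x * (2 * k ^ 2 * x ^ 2 * Real.sinh (a * x) / Real.cosh (a * x) ^ 3) := by ring
      _ ≤ cc (k * x) * (2 * k ^ 2 * x ^ 2 * Real.sinh (a * x) / Real.cosh (a * x) ^ 3) := by
          gcongr
      _ = _ := by ring
  rw [integral_const_mul, h1] at h2
  change k ^ 2 * I2 a ≤ k⁻¹ * I2 b at h2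
  have h3 : k ^ 3 * I2 a ≤ I2 b := by
    have := mul_le_mul_of_nonneg_left h2 hk0.le
    rw [← mul_assoc, ← mul_assoc, mul_inv_cancel₀ hk0.ne'] at this
    linarith
  have := mul_le_mul_of_nonneg_left h3 (pow_pos hb0 3).le
  have e3 : a ^ 3 = b ^ 3 * k ^ 3 := by rw [← hkb]; ring
  rw [e3]
  linarith

/-! cotangent part -/

noncomputable def g (θ : ℝ) : ℝ := Real.cot (θ / 2)
noncomputable def g1 (θ : ℝ) : ℝ := -(1 / (2 * Real.sin (θ / 2) ^ 2))
noncomputable def g2 (θ : ℝ) : ℝ := Real.cos (θ / 2) / (2 * Real.sin (θ / 2) ^ 3)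

lemma sp {θ : ℝ} (hθ : θ ∈ Ioo 0 π) : 0 < Real.sin (θ / 2) :=
  Real.sin_pos_of_pos_of_lt_pi (by linarith [hθ.1]) (by linarith [hθ.1, hθ.2])
lemma cp {θ : ℝ} (hθ : θ ∈ Ioo 0 π) : 0 < Real.cos (θ / 2) :=
  Real.cos_pos_of_mem_Ioo ⟨by linarith [hθ.1, pi_pos], by linarith [hθ.1, hθ.2]⟩

lemma g2_pos {θ : ℝ} (hθ : θ ∈ Ioo 0 π) : 0 < g2 θ := by
  have := sp hθ
  have := cp hθ
  unfold g2; positivity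

lemma dhalf (θ : ℝ) : HasDerivAt (fun t : ℝ => t / 2) (1/2) θ := (hasDerivAt_id θ).div_const 2

lemma dg {θ : ℝ} (hθ : θ ∈ Ioo 0 π) : HasDerivAt g (g1 θ) θ := by
  have hs := (sp hθ).ne'
  have e : g = fun t => Real.cos (t / 2) / Real.sin (t / 2) := by
    ext t; exact Real.cot_eq_cos_div_sin _
  rw [e]
  refine ((dhalf θ).cos.div (dhalf θ).sin hs).congr_deriv ?_
  unfold g1
  have := Real.sin_sq_add_cos_sq (θ / 2)
  field_simp
  linear_combination (-1) * this

lemma dg1 {θ : ℝ} (hθ : θ ∈ Ioo 0 π) : HasDerivAt g1 (g2 θ) θ := by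
  have hs := (sp hθ).ne'
  have := ((hasDerivAt_const θ (1:ℝ)).div (((dhalf θ).sin.pow 2).const_mul 2)
    (mul_ne_zero two_ne_zero (pow_ne_zero 2 hs))).neg
  refine this.congr_deriv ?_
  unfold g2
  simp
  field_simp
  try ring

lemma cusa {x : ℝ} (hx : x ∈ Ioo 0 π) : 3 * Real.sin x < x * (2 + Real.cos x) := by
  have hm : StrictMonoOn (fun x => x * (2 + Real.cos x) - 3 * Real.sin x) (Icc 0 π) := by
    refine strictMonoOn_of_deriv_pos (convex_Icc _ _) (by fun_prop) fun y hy => ?_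
    rw [interior_Icc] at hy
    have hd : HasDerivAt (fun x => x * (2 + Real.cos x) - 3 * Real.sin x)
        (1 * (2 + Real.cos y) + y * (-Real.sin y) - 3 * Real.cos y) y :=
      ((hasDerivAt_id y).mul ((Real.hasDerivAt_cos y).const_add 2)).sub
        ((Real.hasDerivAt_sin y).const_mul 3)
    rw [hd.deriv]
    have hs := sp hy
    have hc := cp hy
    have ht := Real.lt_tan (x := y / 2) (by linarith [hy.1]) (by linarith [hy.2])
    rw [Real.tan_eq_sin_div_cos, lt_div_iff₀ hc] at ht
    have e1 : Real.sin y = 2 * Real.sin (y/2) * Real.cos (y/2) := by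
      rw [← Real.sin_two_mul]; congr 1; ring
    have e2 : Real.cos y = 1 - 2 * Real.sin (y/2) ^ 2 := by
      have := Real.cos_two_mul (y/2)
      rw [show 2 * (y/2) = y by ring] at this
      have := Real.sin_sq_add_cos_sq (y / 2)
      linarith
    rw [e1, e2]
    nlinarith [mul_pos hs (sub_pos.2 ht)]
  have := hm (left_mem_Icc.2 pi_pos.le) ⟨hx.1.le, hx.2.le⟩ hx.1
  simp at this
  linarith

lemma R_anti : StrictAntiOn (fun θ => θ ^ 3 * g2 θ) (Ioo 0 π) := by
  have hD : ∀ y ∈ Ioo 0 π, HasDerivAt (fun θ => θ ^ 3 * g2 θ)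
      (y ^ 2 * (3 * Real.sin y - y * (2 + Real.cos y)) / (4 * Real.sin (y/2) ^ 4)) y := by
    intro y hy
    have hs := (sp hy).ne'
    have h1 := (dhalf y).cos.div (((dhalf y).sin.pow 3).const_mul 2)
      (mul_ne_zero two_ne_zero (pow_ne_zero 3 hs))
    have h2 := (hasDerivAt_pow 3 y).mul h1
    refine h2.congr_deriv ?_
    have e1 : Real.sin y = 2 * Real.sin (y/2) * Real.cos (y/2) := by
      rw [← Real.sin_two_mul]; congr 1; ring
    have e2 : Real.cos y = 2 * Real.cos (y/2) ^ 2 - 1 := by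
      rw [← Real.cos_two_mul]; congr 1; ring
    have := Real.sin_sq_add_cos_sq (y / 2)
    rw [e1, e2]
    simp
    field_simp
    have e3 : Real.sin (y/2) ^ 2 = 1 - Real.cos (y/2) ^ 2 := by linarith
    ring_nf
    ring_nf at e3
    try rw [e3]
    try ring
  refine strictAntiOn_of_deriv_neg (convex_Ioo _ _)
    (fun y hy => (hD y hy).continuousAt.continuousWithinAt) fun y hy => ?_
  rw [interior_Ioo] at hy
  rw [(hD y hy).deriv]
  have hs := sp hy
  have hy0 := hy.1
  refine div_neg_of_neg_of_pos (mul_neg_of_pos_of_neg (by positivity) ?_) (by positivity)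
  linarith [cusa hy]

/-! second-derivative criterion -/

lemma conv_of {S : Set ℝ} (hS : Convex ℝ S) {f f1 f2 : ℝ → ℝ} (hSub : S ⊆ Ioo 0 π)
    (h1 : ∀ x ∈ Ioo 0 π, HasDerivAt f (f1 x) x) (h2 : ∀ x ∈ Ioo 0 π, HasDerivAt f1 (f2 x) x)
    (hp : ∀ x ∈ interior S, 0 < f2 x) : StrictConvexOn ℝ S f := by
  refine strictConvexOn_of_deriv2_pos hS
    (fun x hx => (h1 x (hSub hx)).continuousAt.continuousWithinAt) fun x hx => ?_
  have hx' := hSub (interior_subset hx)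
  have : deriv f =ᶠ[𝓝 x] f1 := by
    filter_upwards [isOpen_Ioo.mem_nhds hx'] with y hy using (h1 y hy).deriv
  change 0 < deriv (deriv f) x
  rw [this.deriv_eq, (h2 x hx').deriv]
  exact hp x hx

lemma maj2 {S : Set ℝ} {f : ℝ → ℝ} (hf : StrictConvexOn ℝ S f) {a d x y : ℝ} (ha : a ∈ S)
    (hd : d ∈ S) (hx : a < x) (hy : a < y) (h : x + y = a + d) : f x + f y < f a + f d := by
  have had : a < d := by linarith
  have hda : 0 < d - a := by linarith
  set s := (d - x) / (d - a) with hs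
  set t := (x - a) / (d - a) with ht
  have hs0 : 0 < s := div_pos (by linarith) hda
  have ht0 : 0 < t := div_pos (by linarith) hda
  have hst : s + t = 1 := by rw [hs, ht]; field_simp; ring
  have hsd : s * (d - a) = d - x := by rw [hs]; field_simp
  have ex : s * a + t * d = x := by
    rw [show t = 1 - s by linarith]; linarith
  have ey : t * a + s * d = y := by
    rw [show t = 1 - s by linarith]; linarith
  have i1 := hf.2 ha hd had.ne hs0 ht0 hst
  have i2 := hf.2 ha hd had.ne ht0 hs0 (by linarith)
  simp only [smul_eq_mul] at i1 i2
  rw [ex] at i1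
  rw [ey] at i2
  have e : t = 1 - s := by linarith
  rw [e] at i1 i2
  linarith

lemma maj2' {S : Set ℝ} {f : ℝ → ℝ} (hf : StrictConvexOn ℝ S f) {a d x y : ℝ} (ha : a ∈ S)
    (hd : d ∈ S) (hx : a ≤ x) (hy : a ≤ y) (h : x + y = a + d) : f x + f y ≤ f a + f d := by
  rcases hx.eq_or_lt with rfl | hx
  · have : y = d := by linarith
    rw [this]
  rcases hy.eq_or_lt with rfl | hy
  · have : x = d := by linarith
    rw [this]; linarith
  exact (maj2 hf ha hd hx hy h).le

lemma g_conv : StrictConvexOn ℝ (Ioo 0 π) g :=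
  conv_of (convex_Ioo _ _) Subset.rfl (fun _ h => dg h) (fun _ h => dg1 h)
    fun x hx => g2_pos (interior_subset hx)

lemma dphi {θ : ℝ} (hθ : θ ∈ Ioo 0 π) : HasDerivAt phi (I1 θ) θ := by
  have : phi = fun t => ∫ ξ in Ioi (0:ℝ), F0 t ξ := funext phi_eq
  rw [this]; exact (D0 hθ).2

lemma dI1 {θ : ℝ} (hθ : θ ∈ Ioo 0 π) : HasDerivAt I1 (I2 θ) θ := (D1 hθ).2

lemma exists_c {t : ℝ} (ht : t ∈ Ioo 0 π) : ∃ c : ℝ,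
    StrictConvexOn ℝ (Ioc 0 t) (fun x => c * g x - phi x) ∧
    StrictConvexOn ℝ (Ico t π) (fun x => phi x - c * g x) := by
  have hI := I2_pos ht
  have hg := g2_pos ht
  have ht0 := ht.1
  have key : ∀ x ∈ Ioo 0 π, x ^ 3 * (I2 t / g2 t * g2 x - I2 x) =
      (I2 t / g2 t) * (x ^ 3 * g2 x - t ^ 3 * g2 t) + (t ^ 3 * I2 t - x ^ 3 * I2 x) := by
    intro x hx; field_simp; ring
  have hc : 0 < I2 t / g2 t := by positivity
  refine ⟨I2 t / g2 t, ?_, ?_⟩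
  · refine conv_of (convex_Ioc _ _) (fun x hx => ⟨hx.1, hx.2.trans_lt ht.2⟩)
      (fun x h => ((dg h).const_mul _).sub (dphi h))
      (fun x h => ((dg1 h).const_mul _).sub (dI1 h)) fun x hx => ?_
    rw [interior_Ioc] at hx
    have hx' : x ∈ Ioo 0 π := ⟨hx.1, hx.2.trans ht.2⟩
    have k1 := R_anti hx' ht hx.2
    have k2 := I2_mono hx' ht hx.2.le
    have hx3 : 0 < x ^ 3 := pow_pos hx.1 3
    refine pos_of_mul_pos_right (a := x ^ 3) ?_ hx3.le
    rw [key x hx']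
    have := mul_pos hc (sub_pos.2 k1)
    simp only at this
    linarith
  · refine conv_of (convex_Ico _ _) (fun x hx => ⟨ht.1.trans_le hx.1, hx.2⟩)
      (fun x h => (dphi h).sub ((dg h).const_mul _))
      (fun x h => (dI1 h).sub ((dg1 h).const_mul _)) fun x hx => ?_
    rw [interior_Ico] at hx
    have hx' : x ∈ Ioo 0 π := ⟨ht.1.trans hx.1, hx.2⟩
    have k1 := R_anti ht hx' hx.1
    have k2 := I2_mono ht hx' hx.1.le
    have hx3 : 0 < x ^ 3 := pow_pos hx'.1 3
    refine pos_of_mul_pos_right (a := x ^ 3) ?_ hx3.le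
    have := mul_pos hc (sub_pos.2 k1)
    simp only at this
    have := key x hx'
    linarith

lemma core {a₁ a₂ a₃ b₁ b₂ b₃ : ℝ} (ha : a₁ ≤ a₂) (ha' : a₂ ≤ a₃) (hb : b₁ ≤ b₂)
    (hb' : b₂ ≤ b₃) (ha₁ : a₁ ∈ Ioo 0 π) (ha₂ : a₂ ∈ Ioo 0 π) (ha₃ : a₃ ∈ Ioo 0 π)
    (hb₃ : b₃ ∈ Ioo 0 π)
    (hs : a₁ + a₂ + a₃ = b₁ + b₂ + b₃) (hg : g a₁ + g a₂ + g a₃ = g b₁ + g b₂ + g b₃)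
    (hp : phi a₁ + phi a₂ + phi a₃ = phi b₁ + phi b₂ + phi b₃) (h : a₁ < b₁) : False := by
  rcases le_or_gt b₃ a₃ with h3 | h3
  · rcases le_or_gt (b₁ + b₃) (a₁ + a₃) with hm | hm
    · have i1 := maj2 g_conv ha₁ ha₃ (x := b₁) (y := a₁ + a₃ - b₁) h (by linarith) (by ring)
      have hM : a₁ + a₃ - b₁ ∈ Ioo 0 π := ⟨by linarith [hb₃.1], by linarith [ha₃.2]⟩
      have i2 := maj2' g_conv ha₂ hM (x := b₂) (y := b₃) (by linarith) (by linarith) (by linarith)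
      linarith
    · have hM : a₁ + a₃ - b₃ ∈ Ioo 0 π := ⟨by linarith [ha₁.1], by linarith [ha₂.2]⟩
      have i1 := maj2' g_conv ha₁ ha₃ (x := b₃) (y := a₁ + a₃ - b₃) (by linarith) (by linarith)
        (by ring)
      have i2 := maj2 g_conv hM ha₂ (x := b₁) (y := b₂) (by linarith) (by linarith) (by linarith)
      linarith
  · set t := b₁ + b₂ - a₁ with ht
    have ht2 : t = a₂ + a₃ - b₃ := by linarith
    have htI : t ∈ Ioo 0 π := ⟨by linarith [ha₁.1], by linarith [ha₂.2]⟩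
    obtain ⟨c, h1, h2⟩ := exists_c htI
    have i1 := maj2 h1 (a := a₁) (d := t) (x := b₁) (y := b₂) ⟨ha₁.1, by linarith⟩
      ⟨htI.1, le_rfl⟩ h (by linarith) (by linarith)
    have i2 := maj2 h2 (a := t) (d := b₃) (x := a₂) (y := a₃) ⟨le_rfl, htI.2⟩
      ⟨by linarith, hb₃.2⟩ (by linarith) (by linarith) (by linarith)
    have : c * (g a₁ + g a₂ + g a₃) = c * (g b₁ + g b₂ + g b₃) := by rw [hg]
    linarith

lemma core_eq {a₁ a₂ a₃ b₁ b₂ b₃ : ℝ} (ha : a₁ ≤ a₂) (ha' : a₂ ≤ a₃) (hb : b₁ ≤ b₂)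
    (hb' : b₂ ≤ b₃) (ha₁ : a₁ ∈ Ioo 0 π) (ha₂ : a₂ ∈ Ioo 0 π) (ha₃ : a₃ ∈ Ioo 0 π)
    (hb₁ : b₁ ∈ Ioo 0 π) (hb₂ : b₂ ∈ Ioo 0 π) (hb₃ : b₃ ∈ Ioo 0 π)
    (hs : a₁ + a₂ + a₃ = b₁ + b₂ + b₃) (hg : g a₁ + g a₂ + g a₃ = g b₁ + g b₂ + g b₃)
    (hp : phi a₁ + phi a₂ + phi a₃ = phi b₁ + phi b₂ + phi b₃) :
    a₁ = b₁ ∧ a₂ = b₂ ∧ a₃ = b₃ := by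
  rcases lt_trichotomy a₁ b₁ with h | h | h
  · exact (core ha ha' hb hb' ha₁ ha₂ ha₃ hb₃ hs hg hp h).elim
  · subst h
    rcases lt_trichotomy a₂ b₂ with h | h | h
    · have := maj2 g_conv ha₂ ha₃ h (h.trans_le hb') (by linarith)
      linarith
    · exact ⟨rfl, h, by linarith⟩
    · have := maj2 g_conv hb₂ hb₃ h (h.trans_le ha') (by linarith)
      linarith
  · exact (core hb hb' ha ha' hb₁ hb₂ hb₃ ha₃ hs.symm hg.symm hp.symm h).elim

lemma sort3 (a b c : ℝ) : ∃ x y z : ℝ, x ≤ y ∧ y ≤ z ∧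
    ({a, b, c} : Multiset ℝ) = ({x, y, z} : Multiset ℝ) := by
  have e1 : ∀ a b c : ℝ, ({a, b, c} : Multiset ℝ) = {b, a, c} := fun a b c =>
    Multiset.cons_swap a b {c}
  have e2 : ∀ a b c : ℝ, ({a, b, c} : Multiset ℝ) = {a, c, b} := fun a b c => by
    show a ::ₘ (b ::ₘ {c}) = a ::ₘ (c ::ₘ {b})
    congr 1
    exact Multiset.pair_comm b c
  rcases le_total a b with h | h <;> rcases le_total b c with h' | h' <;>
    rcases le_total a c with h'' | h''
  · exact ⟨a, b, c, h, h', rfl⟩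
  · exact ⟨a, b, c, h, h', rfl⟩
  · exact ⟨a, c, b, h'', h', e2 _ _ _⟩
  · exact ⟨c, a, b, h'', h, by rw [e2, e1]⟩
  · exact ⟨b, a, c, h, h'', e1 _ _ _⟩
  · exact ⟨b, c, a, h', h'', by rw [e1, e2]⟩
  · exact ⟨c, b, a, h', h, by rw [e1, e2, e1]⟩
  · exact ⟨c, b, a, h', h, by rw [e1, e2, e1]⟩

lemma sum3 {a b c x y z : ℝ} (h : ({a, b, c} : Multiset ℝ) = ({x, y, z} : Multiset ℝ))
    (f : ℝ → ℝ) : f a + f b + f c = f x + f y + f z := by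
  have := congrArg (fun s => (Multiset.map f s).sum) h
  simp at this
  linarith

lemma mem3 {a b c x y z : ℝ} {S : Set ℝ}
    (h : ({a, b, c} : Multiset ℝ) = ({x, y, z} : Multiset ℝ))
    (ha : a ∈ S) (hb : b ∈ S) (hc : c ∈ S) : x ∈ S ∧ y ∈ S ∧ z ∈ S := by
  have key : ∀ w ∈ ({a, b, c} : Multiset ℝ), w ∈ S := by
    intro w hw
    simp at hw
    rcases hw with rfl | rfl | rfl <;> assumption
  rw [h] at key
  exact ⟨key x (by simp), key y (by simp), key z (by simp)⟩

end HeatTri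

theorem heat_content_determines_triangles
    (α β γ α' β' γ' : ℝ)
    (hα : α ∈ Ioo 0 π) (hβ : β ∈ Ioo 0 π) (hγ : γ ∈ Ioo 0 π)
    (hα' : α' ∈ Ioo 0 π) (hβ' : β' ∈ Ioo 0 π) (hγ' : γ' ∈ Ioo 0 π)
    (hsum : α + β + γ = π) (hsum' : α' + β' + γ' = π)
    (hcot : Real.cot (α / 2) + Real.cot (β / 2) + Real.cot (γ / 2) =
            Real.cot (α' / 2) + Real.cot (β' / 2) + Real.cot (γ' / 2))
    (hphi : phi α + phi β + phi γ = phi α' + phi β' + phi γ') :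
    ({α', β', γ'} : Multiset ℝ) = ({α, β, γ} : Multiset ℝ) := by
  obtain ⟨x, y, z, hxy, hyz, h⟩ := HeatTri.sort3 α β γ
  obtain ⟨x', y', z', hxy', hyz', h'⟩ := HeatTri.sort3 α' β' γ'
  obtain ⟨hx, hy, hz⟩ := HeatTri.mem3 h hα hβ hγ
  obtain ⟨hx', hy', hz'⟩ := HeatTri.mem3 h' hα' hβ' hγ'
  have s1 := HeatTri.sum3 h id
  have s2 := HeatTri.sum3 h' id
  have p1 := HeatTri.sum3 h phi
  have p2 := HeatTri.sum3 h' phi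
  have g1 := HeatTri.sum3 h HeatTri.g
  have g2 := HeatTri.sum3 h' HeatTri.g
  have hcot' : HeatTri.g α + HeatTri.g β + HeatTri.g γ =
    HeatTri.g α' + HeatTri.g β' + HeatTri.g γ' := hcot
  simp only [id] at s1 s2
  obtain ⟨rfl, rfl, rfl⟩ := HeatTri.core_eq hxy hyz hxy' hyz' hx hy hz hx' hy' hz'
    (by linarith) (by linarith) (by linarith)
  rw [h, h']
end

section
/- The derivative of the function θ ↦ φ(θ) − (log 2 / 2)·cot(θ/2) is itself a convex function on the interval (0,π); that is, φ' − (log 2 / 2)·ψ' is convex on (0,π), where ψ(θ) = cot(θ/2). -/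
open Real Set

open MeasureTheory Filter Topology

/-- The weight `coth (π ξ) - 1`. -/
noncomputable def wK (ξ : ℝ) : ℝ := Real.exp (-(π * ξ)) / Real.sinh (π * ξ)

lemma wK_nonneg {ξ : ℝ} (h : 0 < ξ) : 0 ≤ wK ξ := by
  have : 0 < Real.sinh (π * ξ) := Real.sinh_pos_iff.2 (by positivity)
  unfold wK; positivity

lemma wK_meas : Measurable wK := by
  unfold wK; fun_prop

lemma wK_mul_le {ξ : ℝ} (h : 0 < ξ) : ξ * wK ξ ≤ Real.exp (-(π * ξ)) := by
  have h0 : 0 < π * ξ := by positivity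
  have h1 : π * ξ ≤ Real.sinh (π * ξ) := Real.self_le_sinh_iff.2 h0.le
  have h2 : ξ ≤ Real.sinh (π * ξ) := by nlinarith [Real.pi_gt_three]
  unfold wK
  rw [mul_div_assoc', div_le_iff₀ (by linarith)]
  nlinarith [Real.exp_pos (-(π * ξ))]

lemma cosh_le_exp_abs {x y : ℝ} (hx : 0 ≤ x) (h : x ≤ y) : Real.cosh x ≤ Real.exp y := by
  rw [Real.cosh_eq]
  have h1 := Real.exp_le_exp.2 h
  have h2 : Real.exp (-x) ≤ Real.exp y := Real.exp_le_exp.2 (by linarith)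
  linarith

lemma sinh_le_mul_cosh {x : ℝ} (hx : 0 ≤ x) : Real.sinh x ≤ x * Real.cosh x := by
  have hm : MonotoneOn (fun x : ℝ => x * Real.cosh x - Real.sinh x) (Ici 0) := by
    apply monotoneOn_of_deriv_nonneg (convex_Ici 0) (by fun_prop) (by fun_prop)
    intro x hx
    simp only [interior_Ici, mem_Ioi] at hx
    have : HasDerivAt (fun x : ℝ => x * Real.cosh x - Real.sinh x)
        (1 * Real.cosh x + x * Real.sinh x - Real.cosh x) x :=
      ((hasDerivAt_id x).mul (Real.hasDerivAt_cosh x)).sub (Real.hasDerivAt_sinh x)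
    rw [this.deriv]
    have := Real.sinh_pos_iff.2 hx
    nlinarith
  have := hm (mem_Ici.2 le_rfl) hx hx
  simp at this
  linarith

/-- generic integrability criterion -/
lemma integrable_of_bound {f : ℝ → ℝ} (hf : Measurable f) {b C : ℝ} (hb : b < π)
    (h : ∀ ξ, 0 < ξ → |f ξ| ≤ C * Real.exp ((b - π) * ξ)) : IntegrableOn f (Ioi 0) := by
  have h1 : IntegrableOn (fun ξ => C * Real.exp ((b - π) * ξ)) (Ioi 0) :=
    (integrableOn_exp_mul_Ioi (by linarith) 0).const_mul C
  refine Integrable.mono' h1 hf.aestronglyMeasurable ?_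
  filter_upwards [ae_restrict_mem measurableSet_Ioi] with ξ hξ
  exact h ξ hξ

lemma wK_cosh_bound {θ b ξ : ℝ} (h0 : 0 ≤ θ) (hb : θ ≤ b) (hξ : 0 < ξ) :
    ξ * wK ξ * Real.cosh (θ * ξ) ≤ Real.exp ((b - π) * ξ) := by
  have h1 := wK_mul_le hξ
  have h2 : Real.cosh (θ * ξ) ≤ Real.exp (b * ξ) :=
    cosh_le_exp_abs (by positivity) (by nlinarith)
  have h3 : Real.exp ((b - π) * ξ) = Real.exp (-(π * ξ)) * Real.exp (b * ξ) := by
    rw [← Real.exp_add]; congr 1; ring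
  rw [h3]
  have := Real.cosh_pos (θ * ξ)
  exact mul_le_mul h1 h2 this.le (Real.exp_pos _).le

lemma int_wK_sinh {θ : ℝ} (h0 : 0 < θ) (hπ : θ < π) :
    IntegrableOn (fun ξ => wK ξ * Real.sinh (θ * ξ)) (Ioi 0) := by
  refine integrable_of_bound (b := θ) (C := θ) ?_ hπ ?_
  · have := wK_meas; fun_prop
  · intro ξ hξ
    have h1 := wK_nonneg hξ
    have h2 : 0 ≤ Real.sinh (θ * ξ) := Real.sinh_nonneg_iff.2 (by positivity)
    have h3 := sinh_le_mul_cosh (x := θ * ξ) (by positivity)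
    have h4 := wK_cosh_bound h0.le le_rfl hξ
    rw [abs_of_nonneg (by positivity)]
    calc _ ≤ wK ξ * (θ * ξ * Real.cosh (θ * ξ)) := by gcongr
      _ = θ * (ξ * wK ξ * Real.cosh (θ * ξ)) := by ring
      _ ≤ _ := by gcongr

lemma int_wK_tanh {θ : ℝ} (h0 : 0 < θ) (hπ : θ < π) :
    IntegrableOn (fun ξ => wK ξ * (Real.sinh (θ * ξ) / Real.cosh (θ * ξ))) (Ioi 0) := by
  refine Integrable.mono' (int_wK_sinh h0 hπ) ?_ ?_
  · have := wK_meas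
    exact Measurable.aestronglyMeasurable (by fun_prop)
  · filter_upwards [ae_restrict_mem measurableSet_Ioi] with ξ hξ
    have hξ : 0 < ξ := hξ
    have h1 := wK_nonneg hξ
    have h2 : 0 ≤ Real.sinh (θ * ξ) := Real.sinh_nonneg_iff.2 (by positivity)
    have h3 := Real.one_le_cosh (θ * ξ)
    rw [Real.norm_eq_abs, abs_of_nonneg (by positivity)]
    gcongr
    exact div_le_self h2 h3

lemma one_sub_tanh {θ : ℝ} (h0 : 0 < θ) :
    IntegrableOn (fun ξ => 1 - Real.sinh (θ * ξ) / Real.cosh (θ * ξ)) (Ioi 0) ∧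
    ∫ ξ in Ioi (0:ℝ), (1 - Real.sinh (θ * ξ) / Real.cosh (θ * ξ)) = Real.log 2 / θ := by
  have hd : ∀ x ∈ Ici (0:ℝ), HasDerivAt
      (fun ξ => -Real.log (1 + Real.exp (-2 * θ * ξ)) / θ)
      (1 - Real.sinh (θ * x) / Real.cosh (θ * x)) x := by
    intro x _
    have hp : 0 < 1 + Real.exp (-2 * θ * x) := by positivity
    have h1 : HasDerivAt (fun ξ => -2 * θ * ξ) (-2 * θ) x := by
      simpa using (hasDerivAt_id x).const_mul (-2 * θ)
    have h2 := (((h1.exp.const_add 1).log hp.ne').neg).div_const θ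
    refine h2.congr_deriv ?_
    have e : Real.exp (-2 * θ * x) = (Real.exp (θ * x))⁻¹ ^ 2 := by
      rw [← Real.exp_neg, ← Real.exp_nat_mul]; congr 1; push_cast; ring
    have hE := Real.exp_pos (θ * x)
    rw [e, Real.sinh_eq, Real.cosh_eq, Real.exp_neg]
    field_simp
    ring
  have hn : ∀ x ∈ Ioi (0:ℝ), 0 ≤ 1 - Real.sinh (θ * x) / Real.cosh (θ * x) := by
    intro x _
    rw [sub_nonneg, div_le_one (Real.cosh_pos _)]
    exact (Real.sinh_lt_cosh _).le
  have ht : Tendsto (fun ξ => -Real.log (1 + Real.exp (-2 * θ * ξ)) / θ) atTop (𝓝 0) := by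
    have h1 : Tendsto (fun ξ : ℝ => -2 * θ * ξ) atTop atBot :=
      tendsto_id.const_mul_atTop_of_neg (by linarith)
    have h2 := (Real.tendsto_exp_atBot.comp h1).const_add 1
    have h3 := ((h2.log (by norm_num)).neg).div_const θ
    simpa using h3
  refine ⟨integrableOn_Ioi_deriv_of_nonneg' hd hn ht, ?_⟩
  rw [integral_Ioi_of_hasDerivAt_of_nonneg' hd hn ht]
  norm_num
  ring

lemma phi_eq {θ : ℝ} (h0 : 0 < θ) (hπ : θ < π) :
    phi θ = Real.log 2 / θ -
      ∫ ξ in Ioi (0:ℝ), wK ξ * (Real.sinh (θ * ξ) / Real.cosh (θ * ξ)) := by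
  obtain ⟨h1, h2⟩ := one_sub_tanh h0
  rw [← h2, ← integral_sub h1 (int_wK_tanh h0 hπ)]
  unfold phi
  refine setIntegral_congr_fun measurableSet_Ioi ?_
  intro ξ hξ
  have hξ : 0 < ξ := hξ
  have hs : 0 < Real.sinh (π * ξ) := Real.sinh_pos_iff.2 (by positivity)
  have hc := Real.cosh_pos (θ * ξ)
  have e : Real.exp (-(π * ξ)) = Real.cosh (π * ξ) - Real.sinh (π * ξ) :=
    (Real.cosh_sub_sinh _).symm
  simp only [wK]
  rw [e, sub_mul, Real.sinh_sub]
  field_simp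
  ring

lemma mem_compl {x : ℝ} (h0 : 0 < x) (h1 : x < 1) : (x : ℂ) ∈ Complex.integerComplement := by
  rintro ⟨n, hn⟩
  have : (n : ℝ) = x := by exact_mod_cast hn
  have a : (0:ℝ) < n := by linarith
  have b : (n:ℝ) < 1 := by linarith
  have a' : 0 < n := by exact_mod_cast a
  have b' : n < 1 := by exact_mod_cast b
  omega

lemma cot_hasSum {x : ℝ} (h0 : 0 < x) (h1 : x < 1) :
    HasSum (fun n : ℕ => 1 / (x - (n + 1)) + 1 / (x + (n + 1)))
      (π * Real.cot (π * x) - 1 / x) := by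
  have hm := mem_compl h0 h1
  have hs := (summable_cotTerm hm).hasSum
  have h2 := cot_series_rep' hm
  unfold cotTerm at hs
  rw [← h2] at hs
  rw [← Complex.hasSum_ofReal]
  push_cast
  exact hs

lemma wK_hasSum {ξ : ℝ} (hξ : 0 < ξ) :
    HasSum (fun n : ℕ => 2 * Real.exp (-(2 * π * (n + 1) * ξ))) (wK ξ) := by
  have hr : Real.exp (-(2 * π * ξ)) < 1 := by
    rw [Real.exp_lt_one_iff]
    have : 0 < π * ξ := by positivity
    linarith
  have hg := (hasSum_geometric_of_lt_one (Real.exp_pos _).le hr).mul_left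
    (2 * Real.exp (-(2 * π * ξ)))
  have hf : (fun n : ℕ => 2 * Real.exp (-(2 * π * (n + 1) * ξ))) =
      fun n : ℕ => 2 * Real.exp (-(2 * π * ξ)) * Real.exp (-(2 * π * ξ)) ^ n := by
    ext n
    rw [← Real.exp_nat_mul, mul_assoc 2 (Real.exp _), ← Real.exp_add]
    congr 2; ring
  have hv : wK ξ = 2 * Real.exp (-(2 * π * ξ)) * (1 - Real.exp (-(2 * π * ξ)))⁻¹ := by
    unfold wK
    have e : Real.exp (-(2 * π * ξ)) = (Real.exp (π * ξ))⁻¹ ^ 2 := by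
      rw [← Real.exp_neg, ← Real.exp_nat_mul]; congr 1; push_cast; ring
    have hE : 1 < Real.exp (π * ξ) := Real.one_lt_exp_iff.2 (by positivity)
    rw [e, Real.sinh_eq, Real.exp_neg]
    have : (Real.exp (π * ξ)) ^ 2 - 1 ≠ 0 := by nlinarith
    have h3 : Real.exp (π * ξ) - (Real.exp (π * ξ))⁻¹ ≠ 0 := by
      have : (Real.exp (π * ξ))⁻¹ < 1 := inv_lt_one_of_one_lt₀ hE
      linarith
    have h4 : 1 - (Real.exp (π * ξ))⁻¹ ^ 2 ≠ 0 := by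
      have : (Real.exp (π * ξ))⁻¹ < 1 := inv_lt_one_of_one_lt₀ hE
      have : 0 < (Real.exp (π * ξ))⁻¹ := by positivity
      nlinarith
    field_simp
  rw [hf, hv]
  exact hg

lemma cot_eq {θ : ℝ} (h0 : 0 < θ) (hπ : θ < π) :
    ∫ ξ in Ioi (0:ℝ), wK ξ * Real.sinh (θ * ξ) = 1 / θ - Real.cot (θ / 2) / 2 := by
  set F : ℕ → ℝ → ℝ := fun n ξ =>
    2 * Real.exp (-(2 * π * (n + 1) * ξ)) * Real.sinh (θ * ξ) with hF
  have hFe : ∀ n, F n = fun ξ => Real.exp ((θ - 2 * π * (n + 1)) * ξ)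
      - Real.exp ((-θ - 2 * π * (n + 1)) * ξ) := by
    intro n; ext ξ
    have e1 : Real.exp ((θ - 2 * π * (n + 1)) * ξ) =
      Real.exp (-(2 * π * (n + 1) * ξ)) * Real.exp (θ * ξ) := by
      rw [← Real.exp_add]; congr 1; ring
    have e2 : Real.exp ((-θ - 2 * π * (n + 1)) * ξ) =
      Real.exp (-(2 * π * (n + 1) * ξ)) * Real.exp (-(θ * ξ)) := by
      rw [← Real.exp_add]; congr 1; ring
    simp only [hF]
    rw [e1, e2, Real.sinh_eq]; ring
  have hp : ∀ n : ℕ, 2 * π ≤ 2 * π * (n + 1) := by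
    intro n
    have : (0:ℝ) ≤ n := n.cast_nonneg
    nlinarith [Real.pi_pos]
  have n1 : ∀ n : ℕ, θ - 2 * π * (n + 1) < 0 := fun n => by linarith [hp n]
  have n2 : ∀ n : ℕ, -θ - 2 * π * (n + 1) < 0 := fun n => by linarith [hp n]
  have hFi : ∀ n, IntegrableOn (F n) (Ioi 0) := by
    intro n; rw [hFe]
    exact (integrableOn_exp_mul_Ioi (n1 n) 0).sub (integrableOn_exp_mul_Ioi (n2 n) 0)
  have hFv : ∀ n : ℕ, ∫ ξ in Ioi (0:ℝ), F n ξ =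
      (-1 / (2 * π)) * (1 / (θ / (2 * π) - (n + 1)) + 1 / (θ / (2 * π) + (n + 1))) := by
    intro n; rw [hFe, integral_sub (integrableOn_exp_mul_Ioi (n1 n) 0)
      (integrableOn_exp_mul_Ioi (n2 n) 0), integral_exp_mul_Ioi (n1 n), integral_exp_mul_Ioi (n2 n)]
    have hpi := Real.pi_pos
    have a1 : θ / (2 * π) - (n + 1) = (θ - 2 * π * (n + 1)) / (2 * π) := by field_simp
    have a2 : θ / (2 * π) + (n + 1) = -(-θ - 2 * π * (n + 1)) / (2 * π) := by field_simp; ring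
    rw [a1, a2]
    have b1 := (n1 n).ne
    have b2 := (n2 n).ne
    generalize θ - 2 * π * (n + 1) = u at *
    generalize -θ - 2 * π * (n + 1) = v at *
    simp only [mul_zero, Real.exp_zero]
    field_simp
    ring
  have hx0 : 0 < θ / (2 * π) := by positivity
  have hx1 : θ / (2 * π) < 1 := by rw [div_lt_one (by positivity)]; linarith
  have hs := (cot_hasSum hx0 hx1).mul_left (-1 / (2 * π))
  simp_rw [← hFv] at hs
  have hsn : Summable fun n => ∫ ξ in Ioi (0:ℝ), ‖F n ξ‖ := by
    refine hs.summable.congr fun n => ?_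
    refine setIntegral_congr_fun measurableSet_Ioi ?_
    intro ξ hξ
    have hξ : 0 < ξ := hξ
    have : 0 ≤ Real.sinh (θ * ξ) := Real.sinh_nonneg_iff.2 (by positivity)
    exact (Real.norm_of_nonneg (by simp only [hF]; positivity)).symm
  have hh := hasSum_integral_of_summable_integral_norm hFi hsn
  have := hh.unique hs
  have e : ∫ ξ in Ioi (0:ℝ), wK ξ * Real.sinh (θ * ξ) = ∫ ξ in Ioi (0:ℝ), ∑' n, F n ξ := by
    refine setIntegral_congr_fun measurableSet_Ioi ?_
    intro ξ hξ
    exact ((wK_hasSum hξ).mul_right (Real.sinh (θ * ξ))).tsum_eq.symm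
  rw [e, this]
  have a : π * (θ / (2 * π)) = θ / 2 := by field_simp
  rw [a]
  field_simp
  ring

lemma main_eq {θ : ℝ} (h0 : 0 < θ) (hπ : θ < π) :
    phi θ - (Real.log 2 / 2) * Real.cot (θ / 2) =
      ∫ ξ in Ioi (0:ℝ), wK ξ * (Real.log 2 * Real.sinh (θ * ξ)
        - Real.sinh (θ * ξ) / Real.cosh (θ * ξ)) := by
  have h1 := int_wK_sinh h0 hπ
  have h2 := int_wK_tanh h0 hπ
  have : ∀ ξ, wK ξ * (Real.log 2 * Real.sinh (θ * ξ) - Real.sinh (θ * ξ) / Real.cosh (θ * ξ))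
    = Real.log 2 * (wK ξ * Real.sinh (θ * ξ)) - wK ξ * (Real.sinh (θ * ξ) / Real.cosh (θ * ξ)) := by
    intro ξ; ring
  simp_rw [this]
  rw [integral_sub (h1.const_mul _) h2, integral_const_mul, cot_eq h0 hπ, phi_eq h0 hπ]
  ring

/-- The profile `log 2 cosh - sech ^ 2`. -/
noncomputable def gP (x : ℝ) : ℝ := Real.log 2 * Real.cosh x - 1 / Real.cosh x ^ 2

lemma gP_convex : ConvexOn ℝ univ gP := by
  have d1 : ∀ x, HasDerivAt gP (Real.log 2 * Real.sinh x + 2 * Real.sinh x / Real.cosh x ^ 3) x := by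
    intro x
    have hc := Real.cosh_pos x
    have h := ((Real.hasDerivAt_cosh x).const_mul (Real.log 2)).sub
      (((Real.hasDerivAt_cosh x).pow 2).inv (pow_pos hc 2).ne')
    refine (h.congr_deriv ?_).congr_of_eventuallyEq (Eventually.of_forall fun y => ?_)
    · simp; field_simp; ring
    · simp [gP]
  have e1 : deriv gP = fun x => Real.log 2 * Real.sinh x + 2 * Real.sinh x / Real.cosh x ^ 3 :=
    funext fun x => (d1 x).deriv
  have d2 : ∀ x, HasDerivAt (deriv gP) (Real.log 2 * Real.cosh x +
      (2 * Real.cosh x * Real.cosh x ^ 3 - 2 * Real.sinh x * (3 * Real.cosh x ^ 2 * Real.sinh x))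
        / (Real.cosh x ^ 3) ^ 2) x := by
    intro x
    have hc := Real.cosh_pos x
    rw [e1]
    have h := ((Real.hasDerivAt_sinh x).const_mul (Real.log 2)).add
      (((Real.hasDerivAt_sinh x).const_mul 2).div ((Real.hasDerivAt_cosh x).pow 3) (pow_pos hc 3).ne')
    exact h.congr_deriv (by simp)
  refine convexOn_univ_of_deriv2_nonneg (fun x => (d1 x).differentiableAt)
    (fun x => (d2 x).differentiableAt) (fun x => ?_)
  have : deriv^[2] gP x = deriv (deriv gP) x := rfl
  rw [this, (d2 x).deriv]
  have hc := Real.one_le_cosh x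
  have hs : Real.sinh x ^ 2 = Real.cosh x ^ 2 - 1 := by linarith [Real.cosh_sq x]
  have hl : (2:ℝ) / 3 ≤ Real.log 2 := by linarith [Real.log_two_gt_d9]
  set c := Real.cosh x
  have hc0 : 0 < c := by linarith
  have e : (2 * c * c ^ 3 - 2 * Real.sinh x * (3 * c ^ 2 * Real.sinh x)) / (c ^ 3) ^ 2
      = -4 * (1 / c ^ 2) + 6 * (1 / c ^ 2) ^ 2 := by
    have : 2 * Real.sinh x * (3 * c ^ 2 * Real.sinh x) = 6 * c ^ 2 * (c ^ 2 - 1) := by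
      rw [← hs]; ring
    rw [this]; field_simp; ring
  rw [e]
  nlinarith [sq_nonneg (3 * (1 / c ^ 2) - 1)]

lemma gP_abs (x : ℝ) : |gP x| ≤ 2 * Real.cosh x := by
  have hc := Real.one_le_cosh x
  have hl0 : 0 < Real.log 2 := Real.log_pos (by norm_num)
  have hl : Real.log 2 ≤ 1 := by linarith [Real.log_two_lt_d9]
  have h1 : 1 / Real.cosh x ^ 2 ≤ 1 := by
    rw [div_le_one (by positivity)]; nlinarith
  have h2 : 0 ≤ 1 / Real.cosh x ^ 2 := by positivity
  unfold gP
  rw [abs_le]; constructor <;> nlinarith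

lemma gP_meas : Measurable gP := by unfold gP; fun_prop

lemma main_deriv {θ : ℝ} (h0 : 0 < θ) (hπ : θ < π) :
    IntegrableOn (fun ξ => ξ * wK ξ * gP (θ * ξ)) (Ioi 0) ∧
    HasDerivAt (fun θ => phi θ - (Real.log 2 / 2) * Real.cot (θ / 2))
      (∫ ξ in Ioi (0:ℝ), ξ * wK ξ * gP (θ * ξ)) θ := by
  have hK := wK_meas
  have hg := gP_meas
  obtain ⟨b, hb1, hb2⟩ := exists_between hπ
  have key := hasDerivAt_integral_of_dominated_loc_of_deriv_le (μ := volume.restrict (Ioi (0:ℝ)))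
    (F := fun θ ξ => wK ξ * (Real.log 2 * Real.sinh (θ * ξ)
        - Real.sinh (θ * ξ) / Real.cosh (θ * ξ)))
    (F' := fun θ ξ => ξ * wK ξ * gP (θ * ξ)) (x₀ := θ) (s := Ioo 0 b)
    (bound := fun ξ => 2 * Real.exp ((b - π) * ξ)) (Ioo_mem_nhds h0 hb1)
    (Eventually.of_forall fun x => Measurable.aestronglyMeasurable (by fun_prop))
    ?_ (Measurable.aestronglyMeasurable (by fun_prop)) ?_ ?_ ?_
  · refine ⟨key.1, key.2.congr_of_eventuallyEq ?_⟩
    filter_upwards [Ioo_mem_nhds h0 hπ] with x hx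
    exact main_eq hx.1 hx.2
  · have := ((int_wK_sinh h0 hπ).const_mul (Real.log 2)).sub (int_wK_tanh h0 hπ)
    refine this.congr (Eventually.of_forall fun ξ => ?_)
    simp only [Pi.sub_apply]; ring
  · filter_upwards [ae_restrict_mem measurableSet_Ioi] with ξ hξ x hx
    have hξ : 0 < ξ := hξ
    have h1 := wK_cosh_bound hx.1.le hx.2.le hξ
    have h2 := gP_abs (x * ξ)
    have h3 : 0 ≤ ξ * wK ξ := mul_nonneg hξ.le (wK_nonneg hξ)
    rw [Real.norm_eq_abs, abs_mul, abs_of_nonneg h3]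
    nlinarith [mul_le_mul_of_nonneg_left h2 h3]
  · exact (integrableOn_exp_mul_Ioi (by linarith) 0).const_mul 2
  · refine Eventually.of_forall fun ξ x _ => ?_
    have hc := Real.cosh_pos (x * ξ)
    have hl : HasDerivAt (fun x : ℝ => x * ξ) ξ x := by
      simpa using (hasDerivAt_id x).mul_const ξ
    have h := (((hl.sinh).const_mul (Real.log 2)).sub (hl.sinh.div hl.cosh hc.ne')).const_mul (wK ξ)
    refine h.congr_deriv ?_
    have hs := Real.cosh_sq (x * ξ)
    have e : (Real.cosh (x * ξ) * ξ * Real.cosh (x * ξ) - Real.sinh (x * ξ) *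
        (Real.sinh (x * ξ) * ξ)) = ξ := by linear_combination ξ * hs
    rw [e]
    unfold gP
    ring

theorem deriv_phi_sub_log2_half_cot_convexOn :
    ConvexOn ℝ (Ioo (0:ℝ) π)
      (deriv (fun θ => phi θ - (Real.log 2 / 2) * Real.cot (θ / 2))) := by
  refine ⟨convex_Ioo 0 π, ?_⟩
  intro x hx y hy a b ha hb hab
  have hz := convex_Ioo 0 π hx hy ha hb hab
  obtain ⟨ix, dx⟩ := main_deriv hx.1 hx.2
  obtain ⟨iy, dy⟩ := main_deriv hy.1 hy.2
  obtain ⟨iz, dz⟩ := main_deriv hz.1 hz.2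
  rw [dx.deriv, dy.deriv, dz.deriv]
  simp only [smul_eq_mul] at *
  rw [← integral_const_mul, ← integral_const_mul,
    ← integral_add (ix.const_mul a) (iy.const_mul b)]
  refine setIntegral_mono_on iz ((ix.const_mul a).add (iy.const_mul b)) measurableSet_Ioi ?_
  intro ξ hξ
  have hξ : 0 < ξ := hξ
  have h3 : 0 ≤ ξ * wK ξ := mul_nonneg hξ.le (wK_nonneg hξ)
  have hc := gP_convex.2 (mem_univ (x * ξ)) (mem_univ (y * ξ)) ha hb hab
  simp only [smul_eq_mul] at hc
  have e : (a * x + b * y) * ξ = a * (x * ξ) + b * (y * ξ) := by ring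
  rw [e]
  have := mul_le_mul_of_nonneg_left hc h3
  linarith
end
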